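/- arXiv:2009.11936 — 2 statements merged into one kernel-verified Lean document; each statement's English description precedes it below -/
import Mathlib

section
/- Let ε, λ > 0 and q > (λ+ε)/(2ε), and set r = q − λ/(2ε). Let g : [0,1] → ℝ be continuous with ‖g‖² = ∫₀¹ g(x)² dx. Let δ₁, δ₂ > 0 satisfy ε·min{r − 1/2, 1/2} − 5λ/(8δ₁) − ‖g‖²/δ₂ ≥ 0, and let H > 0 satisfy H·ε·min{q − 1/2, 1/2} − (5λδ₁)/8 − (5δ₂)/4 ≥ 0, and suppose ϑ₁ = Hε/4 − 5λδ₁/16 − 5δ₂/8 > 0 and ϑ₂ = ε/4 − 5λ/(16δ₁) − ‖g‖²/(2δ₂) > 0. Let w̃ be a classical solution on [0,1]×[0,∞) of w̃_t = ε w̃_xx with w̃_x(0,t) = 0 and w̃_x(1,t) = −q·w̃(1,t), and let ŵ be a classical solution on [0,1]×[0,∞) of ŵ_t(x,t) = ε ŵ_xx(x,t) + g(x)·w̃(0,t) with ŵ_x(0,t) = −(λ/(2ε))·w̃(0,t) and ŵ_x(1,t) = −r·ŵ(1,t). Then, with c = min{ϑ₁, ϑ₂}/max{H/2, 1/2}, for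 all t ≥ 0: (H/2)·‖w̃[t]‖² + (1/2)·‖ŵ[t]‖² ≤ e^{−c t}·((H/2)·‖w̃[0]‖² + (1/2)·‖ŵ[0]‖²). -/
open Real Set

/-- Regularity of a classical solution of a 1-D parabolic PDE on `[0,1] × I`. -/
structure ClassicalReg (I : Set ℝ) (u ut ux uxx : ℝ → ℝ → ℝ) : Prop where
  cont : ContinuousOn (fun p : ℝ × ℝ => u p.1 p.2) (Icc 0 1 ×ˢ I)
  cont_ut : ContinuousOn (fun p : ℝ × ℝ => ut p.1 p.2) (Icc 0 1 ×ˢ I)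
  cont_ux : ContinuousOn (fun p : ℝ × ℝ => ux p.1 p.2) (Icc 0 1 ×ˢ I)
  cont_uxx : ContinuousOn (fun p : ℝ × ℝ => uxx p.1 p.2) (Icc 0 1 ×ˢ I)
  deriv_t : ∀ x ∈ Icc (0:ℝ) 1, ∀ t ∈ I, HasDerivWithinAt (fun s => u x s) (ut x t) I t
  deriv_x : ∀ x ∈ Icc (0:ℝ) 1, ∀ t ∈ I, HasDerivWithinAt (fun s => u s t) (ux x t) (Icc 0 1) x
  deriv_xx : ∀ x ∈ Icc (0:ℝ) 1, ∀ t ∈ I, HasDerivWithinAt (fun s => ux s t) (uxx x t) (Icc 0 1) x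

theorem sq_integral_mul_le {f g : ℝ → ℝ} {a b : ℝ} (hab : a ≤ b)
    (hf : ContinuousOn f (Icc a b)) (hg : ContinuousOn g (Icc a b)) :
    (∫ x in a..b, f x * g x) ^ 2 ≤ (∫ x in a..b, f x ^ 2) * ∫ x in a..b, g x ^ 2 := by
  have hff : IntervalIntegrable (fun x => f x ^ 2) MeasureTheory.volume a b :=
    (hf.pow 2).intervalIntegrable_of_Icc hab
  have hgg : IntervalIntegrable (fun x => g x ^ 2) MeasureTheory.volume a b :=
    (hg.pow 2).intervalIntegrable_of_Icc hab
  have hfg : IntervalIntegrable (fun x => f x * g x) MeasureTheory.volume a b :=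
    (hf.mul hg).intervalIntegrable_of_Icc hab
  have key : ∀ s : ℝ, 0 ≤ (∫ x in a..b, g x ^ 2) * (s * s) + (2 * ∫ x in a..b, f x * g x) * s
      + ∫ x in a..b, f x ^ 2 := by
    intro s
    have h0 : 0 ≤ ∫ x in a..b, (f x + s * g x) ^ 2 :=
      intervalIntegral.integral_nonneg hab fun x _ => sq_nonneg _
    have h1 : ∫ x in a..b, (f x + s * g x) ^ 2
        = ∫ x in a..b, (f x ^ 2 + (2 * s) * (f x * g x)) + (s * s) * g x ^ 2 := by
      congr 1; ext x; ring
    rw [h1, intervalIntegral.integral_add (hff.add (hfg.const_mul _)) (hgg.const_mul _),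
      intervalIntegral.integral_add hff (hfg.const_mul _), intervalIntegral.integral_const_mul,
      intervalIntegral.integral_const_mul] at h0
    linarith
  have hd := discrim_le_zero key
  rw [discrim] at hd
  linarith

theorem sq_le_endpoint_add_integral_deriv_sq {f f' : ℝ → ℝ}
    (hf : ∀ x ∈ Icc (0:ℝ) 1, HasDerivWithinAt f (f' x) (Icc 0 1) x)
    (hf' : ContinuousOn f' (Icc 0 1)) {x : ℝ} (hx : x ∈ Icc (0:ℝ) 1) :
    f x ^ 2 ≤ 2 * f 1 ^ 2 + 2 * ∫ y in (0:ℝ)..1, f' y ^ 2 := by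
  have hsub : Icc x 1 ⊆ Icc (0:ℝ) 1 := Icc_subset_Icc_left hx.1
  have hftc : ∫ y in x..1, f' y = f 1 - f x :=
    intervalIntegral.integral_eq_sub_of_hasDerivAt_of_le hx.2
      (fun y hy => ((hf y (hsub hy)).mono hsub).continuousWithinAt)
      (fun y hy => (hf y (hsub (Ioo_subset_Icc_self hy))).hasDerivAt
        (Icc_mem_nhds (hx.1.trans_lt hy.1) hy.2))
      ((hf'.mono hsub).intervalIntegrable_of_Icc hx.2)
  have hcs := sq_integral_mul_le hx.2 (hf'.mono hsub) (continuousOn_const (c := (1:ℝ)))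
  simp only [mul_one, one_pow, intervalIntegral.integral_const, smul_eq_mul, hftc] at hcs
  have hmono : ∫ y in x..1, f' y ^ 2 ≤ ∫ y in (0:ℝ)..1, f' y ^ 2 :=
    intervalIntegral.integral_mono_interval hx.1 hx.2 le_rfl
      (Filter.Eventually.of_forall fun y => sq_nonneg _)
      ((hf'.pow 2).intervalIntegrable_of_Icc zero_le_one)
  have hnn : 0 ≤ ∫ y in x..1, f' y ^ 2 :=
    intervalIntegral.integral_nonneg hx.2 fun y _ => sq_nonneg _
  nlinarith [hx.1, hx.2, mul_nonneg hnn hx.1, sq_nonneg (f 1 + (f 1 - f x))]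

theorem integral_sq_le_endpoint_add_integral_deriv_sq {f f' : ℝ → ℝ}
    (hf : ∀ x ∈ Icc (0:ℝ) 1, HasDerivWithinAt f (f' x) (Icc 0 1) x)
    (hf' : ContinuousOn f' (Icc 0 1)) :
    ∫ x in (0:ℝ)..1, f x ^ 2 ≤ 2 * f 1 ^ 2 + 2 * ∫ y in (0:ℝ)..1, f' y ^ 2 := by
  have hfc : ContinuousOn f (Icc 0 1) := fun y hy => (hf y hy).continuousWithinAt
  have h := intervalIntegral.integral_mono_on (μ := MeasureTheory.volume) zero_le_one
    ((hfc.pow 2).intervalIntegrable_of_Icc zero_le_one) intervalIntegrable_const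
    fun x hx => sq_le_endpoint_add_integral_deriv_sq hf hf' hx
  simpa using h

theorem integral_mul_second_deriv {f f' f'' : ℝ → ℝ}
    (hf : ∀ x ∈ Icc (0:ℝ) 1, HasDerivWithinAt f (f' x) (Icc 0 1) x)
    (hf' : ∀ x ∈ Icc (0:ℝ) 1, HasDerivWithinAt f' (f'' x) (Icc 0 1) x)
    (hf'' : ContinuousOn f'' (Icc 0 1)) :
    ∫ x in (0:ℝ)..1, f x * f'' x = f 1 * f' 1 - f 0 * f' 0 - ∫ x in (0:ℝ)..1, f' x ^ 2 := by
  have hfc : ContinuousOn f (Icc 0 1) := fun y hy => (hf y hy).continuousWithinAt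
  have hfc' : ContinuousOn f' (Icc 0 1) := fun y hy => (hf' y hy).continuousWithinAt
  have h1 : IntervalIntegrable (fun x => f' x ^ 2) MeasureTheory.volume 0 1 :=
    (hfc'.pow 2).intervalIntegrable_of_Icc zero_le_one
  have h2 : IntervalIntegrable (fun x => f x * f'' x) MeasureTheory.volume 0 1 :=
    (hfc.mul hf'').intervalIntegrable_of_Icc zero_le_one
  have hftc : ∫ x in (0:ℝ)..1, (f' x ^ 2 + f x * f'' x) = f 1 * f' 1 - f 0 * f' 0 :=
    intervalIntegral.integral_eq_sub_of_hasDerivAt_of_le (f := fun x => f x * f' x) zero_le_one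
      (hfc.mul hfc')
      (fun y hy => by
        have hm := Icc_mem_nhds hy.1 hy.2
        have hy' := Ioo_subset_Icc_self hy
        have := ((hf y hy').hasDerivAt hm).mul ((hf' y hy').hasDerivAt hm)
        rwa [← sq] at this)
      (h1.add h2)
  rw [intervalIntegral.integral_add h1 h2] at hftc
  linarith

namespace ClassicalReg

variable {I : Set ℝ} {u ut ux uxx : ℝ → ℝ → ℝ}

theorem slice {F : ℝ → ℝ → ℝ} (h : ContinuousOn (fun p : ℝ × ℝ => F p.1 p.2) (Icc 0 1 ×ˢ I))
    {t : ℝ} (ht : t ∈ I) : ContinuousOn (fun x => F x t) (Icc 0 1) :=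
  h.comp (f := fun x : ℝ => (x, t)) (by fun_prop) fun _ hx => ⟨hx, ht⟩

theorem continuousOn_integral_sq (h : ClassicalReg (Ici 0) u ut ux uxx) :
    ContinuousOn (fun t => ∫ x in (0:ℝ)..1, u x t ^ 2) (Ici 0) := by
  have hc : Continuous (fun p : ℝ × ℝ => u (max 0 (min 1 p.2)) (max 0 p.1) ^ 2) := by
    refine Continuous.pow ?_ 2
    exact h.cont.comp_continuous (f := fun p : ℝ × ℝ => (max 0 (min 1 p.2), max 0 p.1))
      (by fun_prop)
      fun p => ⟨⟨le_max_left _ _, max_le zero_le_one (min_le_left _ _)⟩,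
        mem_Ici.2 (le_max_left _ _)⟩
  have hI := intervalIntegral.continuous_parametric_intervalIntegral_of_continuous'
    (μ := MeasureTheory.volume)
    (f := fun t x => u (max 0 (min 1 x)) (max 0 t) ^ 2) hc 0 1
  refine hI.continuousOn.congr fun t ht => ?_
  refine intervalIntegral.integral_congr fun x hx => ?_
  rw [uIcc_of_le zero_le_one] at hx
  simp only [min_eq_right hx.2, max_eq_right hx.1, max_eq_right (mem_Ici.1 ht)]

theorem hasDerivAt_integral_sq (h : ClassicalReg (Ici 0) u ut ux uxx) {t : ℝ} (ht : 0 < t) :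
    HasDerivAt (fun t => ∫ x in (0:ℝ)..1, u x t ^ 2) (∫ x in (0:ℝ)..1, 2 * (u x t * ut x t)) t := by
  have hK : IsCompact (Icc (0:ℝ) 1 ×ˢ Icc 0 (2 * t)) := isCompact_Icc.prod isCompact_Icc
  have hsub : Icc (0:ℝ) 1 ×ˢ Icc 0 (2 * t) ⊆ Icc (0:ℝ) 1 ×ˢ Ici 0 :=
    prod_mono le_rfl Icc_subset_Ici_self
  obtain ⟨M, hM⟩ := hK.exists_bound_of_continuousOn
    (((continuousOn_const (c := (2:ℝ))).mul (h.cont.mul h.cont_ut)).mono hsub)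
  have hN : Ioo 0 (2 * t) ∈ nhds t := Ioo_mem_nhds ht (by linarith)
  have hI : uIoc (0:ℝ) 1 ⊆ Icc 0 1 := by
    rw [uIoc_of_le zero_le_one]; exact Ioc_subset_Icc_self
  refine (intervalIntegral.hasDerivAt_integral_of_dominated_loc_of_deriv_le
    (μ := MeasureTheory.volume) (a := 0) (b := 1) (bound := fun _ => M)
    (F := fun t x => u x t ^ 2) (F' := fun t x => 2 * (u x t * ut x t)) hN
    ?_ ?_ ?_ ?_ intervalIntegrable_const ?_).2
  · filter_upwards [hN] with s hs
    exact (((slice h.cont (mem_Ici.2 hs.1.le)).pow 2).mono hI).aestronglyMeasurable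
      measurableSet_uIoc
  · exact ((slice h.cont (mem_Ici.2 ht.le)).pow 2).intervalIntegrable_of_Icc zero_le_one
  · exact ((continuousOn_const.mul ((slice h.cont (mem_Ici.2 ht.le)).mul
      (slice h.cont_ut (mem_Ici.2 ht.le)))).mono hI).aestronglyMeasurable measurableSet_uIoc
  · refine Filter.Eventually.of_forall fun x hx s hs => ?_
    exact hM (x, s) ⟨hI hx, Ioo_subset_Icc_self hs⟩
  · refine Filter.Eventually.of_forall fun x hx s hs => ?_
    exact (((h.deriv_t x (hI hx) s (mem_Ici.2 hs.1.le)).hasDerivAt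
      (Ici_mem_nhds hs.1)).pow 2).congr_deriv (by norm_num [mul_assoc])

theorem integral_mul_ut {ε : ℝ} {k : ℝ} {g : ℝ → ℝ} {t : ℝ} (h : ClassicalReg I u ut ux uxx)
    (ht : t ∈ I) (hg : ContinuousOn g (Icc 0 1))
    (hpde : ∀ x ∈ Ioo (0:ℝ) 1, ut x t = ε * uxx x t + g x * k) :
    ∫ x in (0:ℝ)..1, 2 * (u x t * ut x t)
      = 2 * (ε * (u 1 t * ux 1 t - u 0 t * ux 0 t - ∫ x in (0:ℝ)..1, ux x t ^ 2)
        + k * ∫ x in (0:ℝ)..1, g x * u x t) := by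
  have hu := slice h.cont ht
  have huxx := slice h.cont_uxx ht
  have h1 : IntervalIntegrable (fun x => u x t * uxx x t) MeasureTheory.volume 0 1 :=
    (hu.mul huxx).intervalIntegrable_of_Icc zero_le_one
  have h2 : IntervalIntegrable (fun x => g x * u x t) MeasureTheory.volume 0 1 :=
    (hg.mul hu).intervalIntegrable_of_Icc zero_le_one
  rw [← integral_mul_second_deriv (fun x hx => h.deriv_x x hx t ht)
    (fun x hx => h.deriv_xx x hx t ht) huxx, ← intervalIntegral.integral_const_mul,
    ← intervalIntegral.integral_const_mul, ← intervalIntegral.integral_add (h1.const_mul _) (h2.const_mul _),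
    ← intervalIntegral.integral_const_mul]
  refine intervalIntegral.integral_congr_Ioo_of_le zero_le_one fun x hx => ?_
  simp only [hpde x hx]
  ring

end ClassicalReg

theorem le_exp_mul_of_deriv_le {V V' : ℝ → ℝ} {c : ℝ} (hV : ContinuousOn V (Ici 0))
    (hV' : ∀ t > 0, HasDerivAt V (V' t) t) (hle : ∀ t > 0, V' t ≤ -c * V t) {t : ℝ}
    (ht : 0 ≤ t) : V t ≤ Real.exp (-c * t) * V 0 := by
  have hd : ∀ s > 0, HasDerivAt (fun s => Real.exp (c * s) * V s)
      (Real.exp (c * s) * (c * 1) * V s + Real.exp (c * s) * V' s) s := fun s hs =>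
    (((hasDerivAt_id s).const_mul c).exp).mul (hV' s hs)
  have hanti : AntitoneOn (fun s => Real.exp (c * s) * V s) (Ici 0) := by
    refine antitoneOn_of_deriv_nonpos (convex_Ici 0)
      (ContinuousOn.mul (by fun_prop) hV) ?_ ?_
    · rw [interior_Ici]
      exact fun s hs => (hd s hs).differentiableAt.differentiableWithinAt
    · rw [interior_Ici]
      intro s hs
      rw [(hd s hs).deriv]
      nlinarith [Real.exp_pos (c * s), hle s hs]
  have h := hanti self_mem_Ici (mem_Ici.2 ht) ht
  simp only [mul_zero, Real.exp_zero, one_mul] at h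
  calc V t = Real.exp (-c * t) * (Real.exp (c * t) * V t) := by
        rw [← mul_assoc, ← Real.exp_add]; simp
    _ ≤ _ := by gcongr

theorem young_mul_le (a b : ℝ) {δ : ℝ} (hδ : 0 < δ) : a * b ≤ δ / 2 * a ^ 2 + b ^ 2 / (2 * δ) := by
  have h : δ / 2 * a ^ 2 + b ^ 2 / (2 * δ) - a * b = (δ * a - b) ^ 2 / (2 * δ) := by
    field_simp; ring
  have : 0 ≤ (δ * a - b) ^ 2 / (2 * δ) := by positivity
  linarith

/-- The energy estimate for one component: `k`, `N` stand for the squared boundary value and squared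
`L²` norm of the gradient, `P` for the squared `L²` norm and `z` for the squared value at `0`. -/
theorem dissipation_le {a A p k N P z : ℝ} (ha : 0 < a) (hA : 0 ≤ A) (hk : 0 ≤ k) (hN : 0 ≤ N)
    (hP : 0 ≤ P) (hPk : P ≤ 2 * k + 2 * N) (hz : z ≤ 2 * k + 2 * N)
    (hmin : 5 / 2 * A ≤ a * min (p - 1 / 2) (1 / 2)) :
    -(a * p) * k - a * N + A * z ≤ -(a / 4 - 5 / 4 * A) * P := by
  have h1 : 5 / 2 * A ≤ a * (p - 1 / 2) :=
    hmin.trans (mul_le_mul_of_nonneg_left (min_le_left _ _) ha.le)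
  have h2 : 5 / 2 * A ≤ a * (1 / 2) :=
    hmin.trans (mul_le_mul_of_nonneg_left (min_le_right _ _) ha.le)
  nlinarith [mul_le_mul_of_nonneg_right h1 hk, mul_le_mul_of_nonneg_right h2 hN,
    mul_le_mul_of_nonneg_left hPk ha.le, mul_le_mul_of_nonneg_left hz hA, mul_nonneg hA hP,
    mul_nonneg hA hk, mul_nonneg hA hN]

theorem target_systems_exponential_stability (ε lam q r : ℝ)
    (hε : 0 < ε) (hlam : 0 < lam) (hq : (lam + ε) / (2 * ε) < q)
    (hr : r = q - lam / (2 * ε))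
    (g : ℝ → ℝ) (hg : ContinuousOn g (Icc 0 1))
    (δ₁ δ₂ H : ℝ) (hδ₁ : 0 < δ₁) (hδ₂ : 0 < δ₂) (hH : 0 < H)
    (hδcond : 0 ≤ ε * min (r - 1/2) (1/2) - 5 * lam / (8 * δ₁)
        - (∫ x in (0:ℝ)..1, (g x) ^ 2) / δ₂)
    (hHcond : 0 ≤ H * ε * min (q - 1/2) (1/2) - 5 * lam * δ₁ / 8 - 5 * δ₂ / 4)
    (ϑ₁ ϑ₂ : ℝ)
    (hϑ₁ : ϑ₁ = H * ε / 4 - 5 * lam * δ₁ / 16 - 5 * δ₂ / 8)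
    (hϑ₂ : ϑ₂ = ε / 4 - 5 * lam / (16 * δ₁) - (∫ x in (0:ℝ)..1, (g x) ^ 2) / (2 * δ₂))
    (hϑ₁pos : 0 < ϑ₁) (hϑ₂pos : 0 < ϑ₂)
    -- `v = w̃` is a classical solution of the observer-error target system on `[0,1] × [0,∞)`
    (v vt vx vxx : ℝ → ℝ → ℝ)
    (hvreg : ClassicalReg (Ici 0) v vt vx vxx)
    (hvpde : ∀ x ∈ Ioo (0:ℝ) 1, ∀ t ∈ Ici (0:ℝ), vt x t = ε * vxx x t)
    (hvbc0 : ∀ t ∈ Ici (0:ℝ), vx 0 t = 0)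
    (hvbc1 : ∀ t ∈ Ici (0:ℝ), vx 1 t = -q * v 1 t)
    -- `w = ŵ` is a classical solution of the observer target system on `[0,1] × [0,∞)`
    (w wt wx wxx : ℝ → ℝ → ℝ)
    (hwreg : ClassicalReg (Ici 0) w wt wx wxx)
    (hwpde : ∀ x ∈ Ioo (0:ℝ) 1, ∀ t ∈ Ici (0:ℝ), wt x t = ε * wxx x t + g x * v 0 t)
    (hwbc0 : ∀ t ∈ Ici (0:ℝ), wx 0 t = -(lam / (2 * ε)) * v 0 t)
    (hwbc1 : ∀ t ∈ Ici (0:ℝ), wx 1 t = -r * w 1 t)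
    (c : ℝ) (hc : c = min ϑ₁ ϑ₂ / max (H / 2) (1 / 2)) :
    ∀ t ≥ (0:ℝ),
      H / 2 * (∫ x in (0:ℝ)..1, (v x t) ^ 2) + 1 / 2 * (∫ x in (0:ℝ)..1, (w x t) ^ 2)
        ≤ Real.exp (-c * t) *
          (H / 2 * (∫ x in (0:ℝ)..1, (v x 0) ^ 2)
            + 1 / 2 * ∫ x in (0:ℝ)..1, (w x 0) ^ 2) := by
  set G := ∫ x in (0:ℝ)..1, (g x) ^ 2 with hGdef
  have hG : 0 ≤ G := intervalIntegral.integral_nonneg zero_le_one fun x _ => sq_nonneg _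
  intro t ht
  refine le_exp_mul_of_deriv_le
    (V := fun t => H / 2 * (∫ x in (0:ℝ)..1, (v x t) ^ 2) + 1 / 2 * ∫ x in (0:ℝ)..1, (w x t) ^ 2)
    ((continuousOn_const.mul hvreg.continuousOn_integral_sq).add
      (continuousOn_const.mul hwreg.continuousOn_integral_sq))
    (fun s hs => ((hvreg.hasDerivAt_integral_sq hs).const_mul _).add
      ((hwreg.hasDerivAt_integral_sq hs).const_mul _)) ?_ ht
  intro s hs
  have hs0 : s ∈ Ici (0:ℝ) := mem_Ici.2 hs.le
  have hvx : ∀ x ∈ Icc (0:ℝ) 1, HasDerivWithinAt (fun y => v y s) (vx x s) (Icc 0 1) x :=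
    fun x hx => hvreg.deriv_x x hx s hs0
  have hwx : ∀ x ∈ Icc (0:ℝ) 1, HasDerivWithinAt (fun y => w y s) (wx x s) (Icc 0 1) x :=
    fun x hx => hwreg.deriv_x x hx s hs0
  have hvxc := ClassicalReg.slice hvreg.cont_ux hs0
  have hwxc := ClassicalReg.slice hwreg.cont_ux hs0
  have hcs := sq_integral_mul_le zero_le_one hg (ClassicalReg.slice hwreg.cont hs0)
  have hvP := integral_sq_le_endpoint_add_integral_deriv_sq hvx hvxc
  have hwP := integral_sq_le_endpoint_add_integral_deriv_sq hwx hwxc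
  have hvz := sq_le_endpoint_add_integral_deriv_sq hvx hvxc (left_mem_Icc.2 zero_le_one)
  have hwz := sq_le_endpoint_add_integral_deriv_sq hwx hwxc (left_mem_Icc.2 zero_le_one)
  rw [hvreg.integral_mul_ut (k := 0) hs0 hg fun x hx => by rw [hvpde x hx s hs0]; ring,
    hwreg.integral_mul_ut (k := v 0 s) hs0 hg fun x hx => hwpde x hx s hs0,
    hvbc0 s hs0, hvbc1 s hs0, hwbc0 s hs0, hwbc1 s hs0]
  have hnn : ∀ f : ℝ → ℝ, 0 ≤ ∫ x in (0:ℝ)..1, f x ^ 2 := fun f =>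
    intervalIntegral.integral_nonneg zero_le_one fun x _ => sq_nonneg _
  have hVnn := hnn fun x => v x s
  have hWnn := hnn fun x => w x s
  have hVxnn := hnn fun x => vx x s
  have hWxnn := hnn fun x => wx x s
  beta_reduce at hcs
  rw [← hGdef] at hcs
  set Vn := ∫ x in (0:ℝ)..1, v x s ^ 2
  set Wn := ∫ x in (0:ℝ)..1, w x s ^ 2
  set Vx := ∫ x in (0:ℝ)..1, vx x s ^ 2
  set Wx := ∫ x in (0:ℝ)..1, wx x s ^ 2
  set J := ∫ x in (0:ℝ)..1, g x * w x s
  have hy1 : lam / 2 * (v 0 s * w 0 s)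
      ≤ lam / 2 * (δ₁ / 2 * v 0 s ^ 2 + w 0 s ^ 2 / (2 * δ₁)) :=
    mul_le_mul_of_nonneg_left (young_mul_le (v 0 s) (w 0 s) hδ₁) (half_pos hlam).le
  have hy2 : v 0 s * J ≤ δ₂ / 2 * v 0 s ^ 2 + G * Wn / (2 * δ₂) :=
    (young_mul_le (v 0 s) J hδ₂).trans (by gcongr)
  have e1 : 5 * lam / (8 * δ₁) = 5 / 2 * (lam / (4 * δ₁)) := by field_simp; ring
  have e2 : 5 * lam / (16 * δ₁) = 5 / 4 * (lam / (4 * δ₁)) := by field_simp; ring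
  have e3 : lam / 2 * (w 0 s ^ 2 / (2 * δ₁)) = lam / (4 * δ₁) * w 0 s ^ 2 := by field_simp; ring
  have e4 : G * Wn / (2 * δ₂) = G / (2 * δ₂) * Wn := by ring
  have e5 : ε * (-(lam / (2 * ε)) * v 0 s) = -(lam / 2 * v 0 s) := by field_simp
  have hGd : 0 ≤ G / δ₂ := by positivity
  have hdv := dissipation_le (a := H * ε) (A := lam * δ₁ / 4 + δ₂ / 2) (p := q)
    (by positivity) (by positivity) (sq_nonneg _) hVxnn hVnn hvP hvz (by linarith)
  have hdw := dissipation_le (a := ε) (A := lam / (4 * δ₁)) (p := r)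
    hε (by positivity) (sq_nonneg _) hWxnn hWnn hwP hwz (by linarith)
  have hdecay : c * (H / 2 * Vn + 1 / 2 * Wn) ≤ ϑ₁ * Vn + ϑ₂ * Wn := by
    have hm : 0 < max (H / 2) (1 / 2) := lt_max_of_lt_left (half_pos hH)
    have hcpos : 0 < c := hc ▸ div_pos (lt_min hϑ₁pos hϑ₂pos) hm
    have hcm : c * max (H / 2) (1 / 2) = min ϑ₁ ϑ₂ := by rw [hc]; field_simp
    have h1 : c * (H / 2) ≤ ϑ₁ :=
      (mul_le_mul_of_nonneg_left (le_max_left _ _) hcpos.le).trans (hcm.le.trans (min_le_left _ _))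
    have h2 : c * (1 / 2) ≤ ϑ₂ :=
      (mul_le_mul_of_nonneg_left (le_max_right _ _) hcpos.le).trans
        (hcm.le.trans (min_le_right _ _))
    linarith [mul_le_mul_of_nonneg_right h1 hVnn, mul_le_mul_of_nonneg_right h2 hWnn]
  rw [mul_add, e3] at hy1
  rw [e4] at hy2
  rw [e2] at hϑ₂
  rw [hϑ₁, hϑ₂] at hdecay
  linear_combination hdecay + hdv + hdw + hy1 + hy2 - w 0 s * e5
end

section
/- Let ε, λ > 0 and define L : ℝ² → ℝ by L(x,y) = −(λ/(2ε))·x·∑_{n=0}^∞ (−1)ⁿ·(λ(x²−y²)/(4ε))ⁿ/(n!·(n+1)!) (this equals −(λ/ε)·x·J₁(z)/z with z = √(λ(x²−y²)/ε), where J₁ is the Bessel function of the first kind of order one). Then L is infinitely differentiable on ℝ² and satisfies L_xx(x,y) − L_yy(x,y) = −(λ/ε)·L(x,y) for all (x,y) ∈ ℝ², L_y(x,0) = 0 for all x ∈ ℝ, and L(x,x) = −(λ/(2ε))·x for all x ∈ ℝ. -/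
open Real Set

/-- The entire function `∑ (-1)ⁿ sⁿ / (n! (n + k)!)`, a rescaled Bessel function of order `k`. -/
noncomputable def besselSeries (k : ℕ) (s : ℝ) : ℝ :=
  ∑' n : ℕ, (-1 : ℝ) ^ n * s ^ n / (Nat.factorial n * Nat.factorial (n + k) : ℝ)

lemma summable_besselSeries (k : ℕ) (s : ℝ) :
    Summable fun n : ℕ => (-1 : ℝ) ^ n * s ^ n / (Nat.factorial n * Nat.factorial (n + k) : ℝ) := by
  refine Summable.of_norm_bounded (Real.summable_pow_div_factorial |s|) fun n => ?_
  have h1 : (1 : ℝ) ≤ Nat.factorial (n + k) := by exact_mod_cast Nat.factorial_pos _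
  have h2 : (0 : ℝ) < Nat.factorial n := by exact_mod_cast Nat.factorial_pos _
  rw [norm_div, norm_mul, norm_pow, norm_pow, norm_neg, norm_one, one_pow, one_mul,
    Real.norm_eq_abs, Real.norm_of_nonneg (by positivity)]
  gcongr
  exact le_mul_of_one_le_right h2.le h1

lemma hasDerivAt_besselSeries (k : ℕ) (s : ℝ) :
    HasDerivAt (besselSeries k) (-besselSeries (k + 1) s) s := by
  have hR : s ∈ Metric.ball (0 : ℝ) (|s| + 1) := by simp
  have hu : Summable fun n : ℕ => (n : ℝ) * (|s| + 1) ^ (n - 1) / (Nat.factorial n : ℝ) := by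
    rw [← summable_nat_add_iff 1]
    refine (Real.summable_pow_div_factorial (|s| + 1)).congr fun n => ?_
    have : (n : ℝ) + 1 ≠ 0 := by positivity
    simp only [Nat.factorial_succ, Nat.add_sub_cancel]
    push_cast
    field_simp
  have key := hasDerivAt_tsum_of_isPreconnected hu Metric.isOpen_ball
    (convex_ball (0 : ℝ) (|s| + 1)).isPreconnected
    (g := fun (n : ℕ) (x : ℝ) =>
      (-1 : ℝ) ^ n * x ^ n / (Nat.factorial n * Nat.factorial (n + k) : ℝ))
    (g' := fun (n : ℕ) (x : ℝ) => (-1 : ℝ) ^ n * (n * x ^ (n - 1)) /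
      (Nat.factorial n * Nat.factorial (n + k) : ℝ))
    (fun n x _ => ((hasDerivAt_pow n x).const_mul _).div_const _)
    (fun n x hx => by
      have hx' : |x| ≤ |s| + 1 := by simpa using (mem_ball_zero_iff.mp hx).le
      have h1 : (1 : ℝ) ≤ Nat.factorial (n + k) := by exact_mod_cast Nat.factorial_pos _
      have h2 : (0 : ℝ) < Nat.factorial n := by exact_mod_cast Nat.factorial_pos _
      rw [norm_div, norm_mul, norm_mul, norm_pow, norm_pow, norm_neg, norm_one, one_pow, one_mul,
        Real.norm_eq_abs x, Real.norm_of_nonneg (Nat.cast_nonneg n),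
        Real.norm_of_nonneg (by positivity)]
      gcongr
      exact le_mul_of_one_le_right h2.le h1)
    hR (summable_besselSeries k s) hR
  have hshift : ∀ n : ℕ, -((-1 : ℝ) ^ n * s ^ n /
      (Nat.factorial n * Nat.factorial (n + (k + 1)) : ℝ)) =
      (-1 : ℝ) ^ (n + 1) * ((n + 1 : ℕ) * s ^ (n + 1 - 1)) /
        (Nat.factorial (n + 1) * Nat.factorial (n + 1 + k) : ℝ) := by
    intro n
    have : (n : ℝ) + 1 ≠ 0 := by positivity
    rw [Nat.factorial_succ n, show n + 1 + k = n + (k + 1) by ring, Nat.add_sub_cancel]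
    push_cast
    field_simp
    ring
  refine HasDerivAt.congr_deriv (f := besselSeries k) key ?_
  rw [tsum_eq_zero_add' ((summable_besselSeries (k + 1) s).neg.congr hshift),
    ← tsum_congr hshift, tsum_neg]
  simp [besselSeries]

lemma contDiff_besselSeries (k : ℕ) : ContDiff ℝ (⊤ : ℕ∞) (besselSeries k) := by
  rw [contDiff_infty]
  intro m
  induction m generalizing k with
  | zero =>
    exact contDiff_zero.mpr
      (continuous_iff_continuousAt.mpr fun s => (hasDerivAt_besselSeries k s).continuousAt)
  | succ m ih =>
    have hderiv : deriv (besselSeries k) = fun s => -besselSeries (k + 1) s :=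
      funext fun s => (hasDerivAt_besselSeries k s).deriv
    push_cast
    rw [contDiff_succ_iff_deriv, hderiv]
    exact ⟨fun s => (hasDerivAt_besselSeries k s).differentiableAt, by simp, (ih (k + 1)).neg⟩

lemma besselSeries_recurrence (k : ℕ) (s : ℝ) :
    s * besselSeries (k + 2) s = (k + 1) * besselSeries (k + 1) s - besselSeries k s := by
  have h1 := (summable_besselSeries (k + 1) s).mul_left ((k : ℝ) + 1)
  have h0 := summable_besselSeries k s
  simp only [besselSeries]
  rw [← tsum_mul_left, ← tsum_mul_left, ← h1.tsum_sub h0, (h1.sub h0).tsum_eq_zero_add]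
  have hk : (k : ℝ) + 1 ≠ 0 := by positivity
  have hz : ((k : ℝ) + 1) * ((-1 : ℝ) ^ 0 * s ^ 0 /
      (Nat.factorial 0 * Nat.factorial (0 + (k + 1)) : ℝ)) -
      (-1 : ℝ) ^ 0 * s ^ 0 / (Nat.factorial 0 * Nat.factorial (0 + k) : ℝ) = 0 := by
    simp only [zero_add, Nat.factorial_succ k]
    push_cast
    field_simp
    simp
  rw [hz, zero_add]
  refine tsum_congr fun n => ?_
  have hn : (n : ℝ) + 1 ≠ 0 := by positivity
  have hnk : (n : ℝ) + k + 1 + 1 ≠ 0 := by positivity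
  rw [show n + 1 + (k + 1) = n + k + 1 + 1 by ring, show n + (k + 2) = n + k + 1 + 1 by ring,
    show n + 1 + k = n + k + 1 by ring, Nat.factorial_succ (n + k + 1), Nat.factorial_succ n]
  push_cast
  field_simp
  ring

lemma besselSeries_zero (k : ℕ) : besselSeries k 0 = 1 / Nat.factorial k := by
  rw [besselSeries, tsum_eq_single 0 fun n hn => by simp [hn]]
  simp

lemma hasDerivAt_besselSeries_fst (k : ℕ) (a x y : ℝ) :
    HasDerivAt (fun r => besselSeries k (a * (r ^ 2 - y ^ 2)))
      (-(2 * a * x) * besselSeries (k + 1) (a * (x ^ 2 - y ^ 2))) x := by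
  refine ((hasDerivAt_besselSeries k _).comp x
    (((hasDerivAt_pow 2 x).sub_const (y ^ 2)).const_mul a)).congr_deriv ?_
  push_cast
  ring

lemma hasDerivAt_besselSeries_snd (k : ℕ) (a x y : ℝ) :
    HasDerivAt (fun r => besselSeries k (a * (x ^ 2 - r ^ 2)))
      (2 * a * y * besselSeries (k + 1) (a * (x ^ 2 - y ^ 2))) y := by
  refine ((hasDerivAt_besselSeries k _).comp y
    (((hasDerivAt_pow 2 y).const_sub (x ^ 2)).const_mul a)).congr_deriv ?_
  push_cast
  ring

theorem inverse_kernel_properties (ε lam : ℝ) (hε : 0 < ε) (hlam : 0 < lam)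
    (L : ℝ → ℝ → ℝ)
    (hL : ∀ x y : ℝ, L x y = -(lam / (2 * ε)) * x *
      ∑' n : ℕ, (-1 : ℝ) ^ n * (lam * (x ^ 2 - y ^ 2) / (4 * ε)) ^ n /
        (Nat.factorial n * Nat.factorial (n + 1) : ℝ)) :
    ContDiff ℝ (⊤ : ℕ∞) (fun p : ℝ × ℝ => L p.1 p.2) ∧
    (∀ x y : ℝ,
      deriv (fun s => deriv (fun r => L r y) s) x
        - deriv (fun s => deriv (fun r => L x r) s) y = -(lam / ε) * L x y) ∧
    (∀ x : ℝ, deriv (fun r => L x r) 0 = 0) ∧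
    (∀ x : ℝ, L x x = -(lam / (2 * ε)) * x) := by
  obtain ⟨a, ha⟩ : ∃ a, a = lam / (4 * ε) := ⟨_, rfl⟩
  have hc : lam / (2 * ε) = 2 * a := by rw [ha]; field_simp; ring
  have hd : lam / ε = 4 * a := by rw [ha]; field_simp
  have hF : ∀ x y, L x y = -(2 * a) * x * besselSeries 1 (a * (x ^ 2 - y ^ 2)) := by
    intro x y
    rw [hL, hc, besselSeries, ha, div_mul_eq_mul_div]
  have hx : ∀ x y, HasDerivAt (fun r => L r y) (-(2 * a) * (besselSeries 1 (a * (x ^ 2 - y ^ 2)) -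
      2 * a * x ^ 2 * besselSeries 2 (a * (x ^ 2 - y ^ 2)))) x := by
    intro x y
    simp only [hF]
    refine (((hasDerivAt_id' x).const_mul (-(2 * a))).mul
      (hasDerivAt_besselSeries_fst 1 a x y)).congr_deriv ?_
    ring
  have hy : ∀ x y, HasDerivAt (fun r => L x r)
      (-(2 * a) * x * (2 * a * y * besselSeries 2 (a * (x ^ 2 - y ^ 2)))) y := by
    intro x y
    simp only [hF]
    exact (hasDerivAt_besselSeries_snd 1 a x y).const_mul _
  refine ⟨?_, fun x y => ?_, fun x => ?_, fun x => ?_⟩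
  · simp only [hF]
    exact (contDiff_const.mul contDiff_fst).mul
      ((contDiff_besselSeries 1).comp (by fun_prop))
  · simp only [(hx _ _).deriv, (hy _ _).deriv]
    have hxx := ((hasDerivAt_besselSeries_fst 1 a x y).sub
      (((hasDerivAt_pow 2 x).const_mul (2 * a)).mul
        (hasDerivAt_besselSeries_fst 2 a x y))).const_mul (-(2 * a))
    have hyy := (((hasDerivAt_id' y).const_mul (2 * a)).mul
      (hasDerivAt_besselSeries_snd 2 a x y)).const_mul (-(2 * a) * x)
    have hrec := besselSeries_recurrence 1 (a * (x ^ 2 - y ^ 2))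
    refine (congrArg₂ (· - ·) hxx.deriv hyy.deriv).trans ?_
    rw [hd, hF]
    norm_num at hrec ⊢
    linear_combination (-8 * a ^ 2 * x) * hrec
  · rw [(hy x 0).deriv]
    ring
  · rw [hF, hc, sub_self, mul_zero, besselSeries_zero]
    simp
end
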